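/- arXiv:2410.03562 — 4 statements merged into one kernel-verified Lean document; each statement's English description precedes it below -/
import Mathlib

section
/- Let a, b, c, d, e be nonnegative integers. Then C(a+c+d+e, a+c) · C(b+c+d+e, c+e) = Σ_i C(a+b+c+d+e−i, a+b+c+d) · C(a+d, i+d) · C(b+c, i+c), where the sum is over all integers i (only finitely many terms are nonzero; explicitly it suffices to sum over −min(c,d) ≤ i ≤ min(a,b,e)). -/
/-- Binomial coefficient for integer arguments, with the convention
`ibinom x k = 0` whenever `k < 0` or `k > x`. -/
def ibinom (x k : ℤ) : ℤ :=
  if 0 ≤ k ∧ k ≤ x then Nat.choose x.toNat k.toNat else 0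

theorem ibinom_natCast (x k : ℕ) : ibinom (x : ℤ) (k : ℤ) = (x.choose k : ℤ) := by
  unfold ibinom
  split_ifs with h
  · simp
  · rw [Nat.choose_eq_zero_of_lt (by omega)]
    simp

theorem ibinom_of_neg {x k : ℤ} (h : k < 0) : ibinom x k = 0 :=
  if_neg (by omega)

theorem ibinom_of_lt {x k : ℤ} (h : x < k) : ibinom x k = 0 :=
  if_neg (by omega)

theorem ibinom_natCast_sub (x k : ℕ) : ibinom (x : ℤ) ((x : ℤ) - k) = (x.choose k : ℤ) := by
  rcases le_or_gt k x with h | h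
  · rw [← Nat.cast_sub h, ibinom_natCast, Nat.choose_symm h]
  · rw [ibinom_of_neg (by omega), Nat.choose_eq_zero_of_lt h, Nat.cast_zero]

theorem sum_choose_mul_choose_mul_choose (M N j r : ℕ) :
    ∑ k ∈ Finset.range (j + r + 1), M.choose k * N.choose (j + r - k) * k.choose j =
      M.choose j * (M - j + N).choose r := by
  rw [add_assoc, Finset.sum_range_add, Finset.sum_eq_zero, zero_add, Nat.add_choose_eq,
    Finset.Nat.sum_antidiagonal_eq_sum_range_succ
      (fun p q => (M - j).choose p * N.choose q) r, Finset.mul_sum]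
  · refine Finset.sum_congr rfl fun k _ => ?_
    have h := Nat.choose_mul (n := M) (k := j + k) (s := j) (by omega)
    rw [Nat.add_sub_cancel_left] at h
    rw [Nat.add_sub_add_left, mul_right_comm, h, mul_assoc]
  · intro k hk
    rw [Nat.choose_eq_zero_of_lt (Finset.mem_range.mp hk), mul_zero]

/-- Nanjundiah's identity. -/
theorem sum_choose_mul_choose_mul_choose_add (M N m n p : ℕ) (h : M + N = m + n) :
    ∑ k ∈ Finset.range (n + 1), M.choose k * N.choose (n - k) * (m + p + k).choose (m + n) =
      (m + p).choose m * (M + p).choose n := by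
  have expand : ∀ k ∈ Finset.range (n + 1),
      M.choose k * N.choose (n - k) * (m + p + k).choose (m + n) =
        ∑ j ∈ Finset.range (n + 1),
          M.choose k * N.choose (n - k) * k.choose j * (m + p).choose (m + n - j) := by
    intro k hk
    rw [Finset.mem_range] at hk
    rw [add_comm (m + p) k, Nat.add_choose_eq,
      Finset.Nat.sum_antidiagonal_eq_sum_range_succ
        (fun u v => k.choose u * (m + p).choose v) (m + n), Finset.mul_sum]
    symm
    simp only [mul_assoc]
    refine Finset.sum_subset (Finset.range_mono (by omega)) fun j _ hj => ?_
    rw [Finset.mem_range] at hj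
    rw [Nat.choose_eq_zero_of_lt (show k < j by omega)]
    simp
  rw [Finset.sum_congr rfl expand, Finset.sum_comm, Nat.add_choose_eq M p,
    Finset.Nat.sum_antidiagonal_eq_sum_range_succ
      (fun u v => M.choose u * p.choose v) n, Finset.mul_sum]
  refine Finset.sum_congr rfl fun j hj => ?_
  obtain ⟨r, rfl⟩ := Nat.exists_eq_add_of_le (Nat.lt_succ_iff.mp (Finset.mem_range.mp hj))
  rw [← Finset.sum_mul, sum_choose_mul_choose_mul_choose]
  rcases le_or_gt j M with hM | hM
  · have e₁ : M - j + N = m + r := by omega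
    have e₂ : m + (j + r) - j = m + r := by omega
    have e₃ := Nat.choose_mul (n := m + p) (k := m + r) (s := m) (by omega)
    rw [Nat.add_sub_cancel_left, Nat.add_sub_cancel_left, Nat.choose_symm_add] at e₃
    rw [e₁, e₂, Nat.add_sub_cancel_left, mul_assoc, mul_comm ((m + r).choose r), e₃]
    ring
  · simp [Nat.choose_eq_zero_of_lt hM]

/-- For nonnegative integers `a, b, c, d, e`,
`C(a+c+d+e, a+c) · C(b+c+d+e, c+e)
  = Σ_{i ∈ ℤ} C(a+b+c+d+e−i, a+b+c+d) · C(a+d, i+d) · C(b+c, i+c)`,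
the sum being over all integers `i` (finitely many nonzero terms). -/
theorem stmt_1 (a b c d e : ℕ) :
    ibinom ((a : ℤ) + c + d + e) ((a : ℤ) + c) * ibinom ((b : ℤ) + c + d + e) ((c : ℤ) + e) =
      ∑ᶠ i : ℤ,
        ibinom ((a : ℤ) + b + c + d + e - i) ((a : ℤ) + b + c + d) *
          ibinom ((a : ℤ) + d) (i + d) * ibinom ((b : ℤ) + c) (i + c) := by
  have hfin : ∀ f : ℤ → ℤ, (∀ i, f i ≠ 0 → -(c : ℤ) ≤ i ∧ i ≤ a) →
      ∑ᶠ i, f i = ∑ k ∈ Finset.range (a + c + 1), f ((a : ℤ) - (k : ℕ)) := by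
    intro f hf
    rw [← finsum_comp_equiv (Equiv.subLeft (a : ℤ)),
      finsum_eq_sum_of_support_subset (s := (Finset.range (a + c + 1)).map Nat.castEmbedding),
      Finset.sum_map]
    · rfl
    · intro i hi
      have hi' := hf _ hi
      simp only [Equiv.subLeft_apply] at hi'
      simp only [Finset.coe_map, Set.mem_image, Finset.mem_coe, Finset.mem_range]
      exact ⟨i.toNat, by omega, by simp; omega⟩
  rw [hfin]
  · have key := sum_choose_mul_choose_mul_choose_add (a + d) (b + c) (b + d) (a + c) (c + e)
      (by ring)
    have hL₁ : ibinom ((a : ℤ) + c + d + e) ((a : ℤ) + c) =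
        ((a + d + (c + e)).choose (a + c) : ℕ) := by
      rw [← ibinom_natCast]
      congr 1
      push_cast
      ring
    have hL₂ : ibinom ((b : ℤ) + c + d + e) ((c : ℤ) + e) =
        ((b + d + (c + e)).choose (b + d) : ℕ) := by
      rw [Nat.choose_symm_add, ← ibinom_natCast]
      congr 1
      push_cast
      ring
    rw [hL₁, hL₂, mul_comm, ← Nat.cast_mul, ← key, Nat.cast_sum]
    refine Finset.sum_congr rfl fun k hk => ?_
    rw [Finset.mem_range] at hk
    have h₁ : ibinom ((a : ℤ) + b + c + d + e - (a - k)) ((a : ℤ) + b + c + d) =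
        ((b + d + (c + e) + k).choose (b + d + (a + c)) : ℕ) := by
      rw [← ibinom_natCast]
      congr 1 <;> push_cast <;> ring
    have h₂ : ibinom ((a : ℤ) + d) ((a : ℤ) - k + d) = ((a + d).choose k : ℕ) := by
      rw [← ibinom_natCast_sub]
      congr 1
      push_cast
      ring
    have h₃ : ibinom ((b : ℤ) + c) ((a : ℤ) - k + c) = ((b + c).choose (a + c - k) : ℕ) := by
      rw [← ibinom_natCast]
      congr 1
      omega
    rw [h₁, h₂, h₃]
    push_cast
    ring
  · intro i hi
    by_contra hlt
    apply hi
    rcases lt_or_ge i (-(c : ℤ)) with hc | hc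
    · rw [ibinom_of_neg (k := i + c) (by omega), mul_zero]
    · rw [ibinom_of_lt (x := (a : ℤ) + d) (k := i + d) (by omega), mul_zero, zero_mul]
end

section
/- Assume α and β satisfy conditions (C1), (C2), (C3) and (C4) with t′ = 2t. Then for all natural numbers r₁ ≤ t and r₂ ≤ t, every natural number q with t−r₁ ≤ q ≤ t+r₁ and t−r₂ ≤ q ≤ t+r₂, every natural number a with t−r₁ ≤ a ≤ t+r₁, and every natural number b with t−r₂ ≤ b ≤ t+r₂, one has Σ_{j∈ℤ} CG(r₁,a,q,j) · CG(r₂,b,q,j) · α_{j+a} · β_{j+b} = 0 (all but finitely many terms of the sum vanish). This is the off-diagonal Knill–Laflamme condition ⟨c₁|(E^{r₂,δJ}_{δm₂})†E^{r₁,δJ}_{δm₁}|c₀⟩ = 0 for all absorption-emission error operators of order at most t; inner products between error operators with different δJ vanish automatically since they map to spaces of different total angular momentum. -/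
/-- The explicit (Racah) formula for the Clebsch–Gordan coefficient
`C^{n/2−t+q, j−n/2+t}_{n/2, j+a−n/2; r, t−a}`: for
`−min(a,q) ≤ j ≤ n − max(a, 2t−q)`,
`CG n t r q a j = sqrt( C(n,t+r−q)·C(2r,r+t−q) /
  (C(n+q+r−t+1,r+t−q)·C(n,j+a)·C(2r,a+r−t)·C(n̄+q,j+q)) )
  · Σ_{k=t−r}^{q} (−1)^k · C(q−(t−r),k−(t−r)) · C(t+r−q,a−k) · C(n̄+(t−r),j+k)`,
where `n̄ = n−2t+q`, and `CG n t r q a j = 0` otherwise. -/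
noncomputable def CG (n t r q a : ℕ) (j : ℤ) : ℝ :=
  if -(min (a : ℤ) (q : ℤ)) ≤ j ∧ j ≤ (n : ℤ) - max (a : ℤ) (2 * (t : ℤ) - q) then
    Real.sqrt
      (((ibinom (n : ℤ) ((t : ℤ) + r - q) * ibinom (2 * (r : ℤ)) ((r : ℤ) + t - q) : ℤ) : ℝ) /
        ((ibinom ((n : ℤ) + q + r - t + 1) ((r : ℤ) + t - q) * ibinom (n : ℤ) (j + a) *
            ibinom (2 * (r : ℤ)) ((a : ℤ) + r - t) *
            ibinom ((n : ℤ) - 2 * t + q + q) (j + q) : ℤ) : ℝ)) *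
      ∑ k ∈ Finset.Icc (t - r) q,
        (-1 : ℝ) ^ k *
          ((ibinom ((q : ℤ) - ((t : ℤ) - r)) ((k : ℤ) - ((t : ℤ) - r)) *
              ibinom ((t : ℤ) + r - q) ((a : ℤ) - k) *
              ibinom ((n : ℤ) - 2 * t + q + ((t : ℤ) - r)) (j + k) : ℤ) : ℝ)
  else 0

theorem sum_choose_succ_mul_eq (A : ℕ) (g : ℕ → ℝ) :
    ∑ i ∈ Finset.range (A + 2), ((A + 1).choose i : ℝ) * g i =
      ∑ i ∈ Finset.range (A + 1), (A.choose i : ℝ) * g i +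
        ∑ i ∈ Finset.range (A + 1), (A.choose i : ℝ) * g (i + 1) := by
  rw [Finset.sum_range_succ' _ (A + 1), Finset.sum_range_succ' (fun i => (A.choose i : ℝ) * g i) A]
  simp only [Nat.choose_succ_succ', Nat.cast_add, add_mul, Finset.sum_add_distrib]
  rw [Finset.sum_range_succ (fun i => (A.choose (i + 1) : ℝ) * g (i + 1)) A]
  simp
  ring

theorem sum_choose_succ_mul_index_mul (A : ℕ) (g : ℕ → ℝ) :
    ∑ i ∈ Finset.range (A + 2), ((A + 1).choose i : ℝ) * (i * g i) =
      (A + 1) * ∑ i ∈ Finset.range (A + 1), (A.choose i : ℝ) * g (i + 1) := by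
  rw [Finset.sum_range_succ' _ (A + 1), Finset.mul_sum]
  simp only [Nat.cast_zero, zero_mul, mul_zero, add_zero]
  refine Finset.sum_congr rfl fun i _ => ?_
  have h : ((A + 1 : ℕ) : ℝ) * (A.choose i : ℝ) =
      ((A + 1).choose (i + 1) : ℝ) * ((i + 1 : ℕ) : ℝ) := by
    exact_mod_cast Nat.add_one_mul_choose_eq A i
  push_cast at h ⊢
  linear_combination -g (i + 1) * h

section Moments

variable {N D u v : ℕ} {w : ℕ → ℝ}

theorem sum_choose_mul_eq_zero
    (hw : ∀ e f : ℕ, e + f = D → u ≤ e → v ≤ f →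
      ∑ i ∈ Finset.range (N + 1), (N.choose i : ℝ) * w (i + e) = 0)
    (m : ℕ) {e f : ℕ} (hD : e + f + m = D) (he : u ≤ e) (hf : v ≤ f) :
    ∑ i ∈ Finset.range (N + m + 1), ((N + m).choose i : ℝ) * w (i + e) = 0 := by
  induction m generalizing e f with
  | zero => exact hw e f hD he hf
  | succ m ih =>
    have h := sum_choose_succ_mul_eq (N + m) (fun i => w (i + e))
    have h₁ := ih (e := e) (f := f + 1) (by omega) he (by omega)
    have h₂ := ih (e := e + 1) (f := f) (by omega) (by omega) hf
    simp only [add_right_comm _ 1 e] at h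
    simp only [← add_assoc] at h₂
    rw [h₁, h₂] at h
    simpa [add_assoc] using h

/-- If the binomial moments of order `N` of all shifts of `w` vanish, so do those of order `N + m`
weighted by a polynomial of degree at most `m`. -/
theorem sum_choose_mul_eval_mul_eq_zero
    (hw : ∀ e f : ℕ, e + f = D → u ≤ e → v ≤ f →
      ∑ i ∈ Finset.range (N + 1), (N.choose i : ℝ) * w (i + e) = 0)
    (d : ℕ) {Q : Polynomial ℝ} (hQ : Q.natDegree ≤ d) {m e f : ℕ} (hdm : d ≤ m)
    (hD : e + f + m = D) (he : u ≤ e) (hf : v ≤ f) :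
    ∑ i ∈ Finset.range (N + m + 1),
      ((N + m).choose i : ℝ) * (Q.eval ((i + e : ℕ) : ℝ) * w (i + e)) = 0 := by
  induction d generalizing Q m e f with
  | zero =>
    rw [Polynomial.eq_C_of_natDegree_le_zero hQ]
    have h := sum_choose_mul_eq_zero hw m hD he hf
    simp only [Polynomial.eval_C, mul_left_comm _ (Q.coeff 0), ← Finset.mul_sum]
    rw [h, mul_zero]
  | succ d ih =>
    obtain ⟨m, rfl⟩ : ∃ m', m = m' + 1 := ⟨m - 1, by omega⟩
    set R := Q /ₘ (Polynomial.X - Polynomial.C (e : ℝ)) with hR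
    have hQR : ∀ x : ℝ, Q.eval x = Q.eval (e : ℝ) + (x - e) * R.eval x := fun x => by
      have h := congrArg (Polynomial.eval x)
        (Polynomial.modByMonic_add_div Q (Polynomial.X - Polynomial.C (e : ℝ)))
      simpa only [Polynomial.modByMonic_X_sub_C_eq_C_eval, Polynomial.eval_add, Polynomial.eval_mul,
        Polynomial.eval_sub, Polynomial.eval_X, Polynomial.eval_C] using h.symm
    have hRd : R.natDegree ≤ d := by
      rw [hR, Polynomial.natDegree_divByMonic _ (Polynomial.monic_X_sub_C _),
        Polynomial.natDegree_X_sub_C]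
      omega
    have h₀ := sum_choose_mul_eq_zero hw (m + 1) hD he hf
    have h₁ := sum_choose_succ_mul_index_mul (N + m)
      (fun i => R.eval ((i + e : ℕ) : ℝ) * w (i + e))
    have h₂ := ih hRd (m := m) (e := e + 1) (f := f) (by omega) (by omega) (by omega) hf
    simp only [add_right_comm _ 1 e] at h₁
    simp only [← add_assoc] at h₂
    rw [h₂, mul_zero] at h₁
    calc _ = Q.eval (e : ℝ) * ∑ i ∈ Finset.range (N + (m + 1) + 1),
              ((N + (m + 1)).choose i : ℝ) * w (i + e) +
            ∑ i ∈ Finset.range (N + m + 2), ((N + m + 1).choose i : ℝ) *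
              (i * (R.eval ((i + e : ℕ) : ℝ) * w (i + e))) := by
          rw [Finset.mul_sum, ← add_assoc N m 1, ← Finset.sum_add_distrib]
          refine Finset.sum_congr rfl fun i _ => ?_
          rw [hQR]
          push_cast
          ring
      _ = 0 := by rw [h₀, h₁]; simp

end Moments

theorem choose_mul_choose_mul_choose_add (i l e f : ℕ) :
    (i + l + e + f).choose (i + e) * (i + e).choose e * (l + f).choose f =
      (i + l + e + f).choose (e + f) * (e + f).choose e * (i + l).choose i := by
  have h₁ := Nat.add_choose_mul_factorial_mul_factorial (l + f) (i + e)
  have h₂ := Nat.add_choose_mul_factorial_mul_factorial i e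
  have h₃ := Nat.add_choose_mul_factorial_mul_factorial l f
  have h₄ := Nat.add_choose_mul_factorial_mul_factorial (i + l) (e + f)
  have h₅ := Nat.add_choose_mul_factorial_mul_factorial f e
  have h₆ := Nat.add_choose_mul_factorial_mul_factorial l i
  rw [show l + f + (i + e) = i + l + e + f by ring] at h₁
  rw [show i + l + (e + f) = i + l + e + f by ring] at h₄
  rw [add_comm f e] at h₅
  rw [add_comm l i] at h₆
  have hpos : 0 < e.factorial * f.factorial * i.factorial * l.factorial := by positivity
  refine Nat.eq_of_mul_eq_mul_right hpos ?_
  calc _ = (i + l + e + f).choose (i + e) * ((i + e).choose e * i.factorial * e.factorial) *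
        ((l + f).choose f * l.factorial * f.factorial) := by ring
    _ = (i + l + e + f).choose (e + f) * ((e + f).choose e * f.factorial * e.factorial) *
        ((i + l).choose i * l.factorial * i.factorial) := by
      rw [h₂, h₃, h₅, h₆]; linarith
    _ = _ := by ring

theorem choose_mul_choose_mul_choose_sub {M J e f : ℕ} (hJ : J ≤ M) (hef : e + f ≤ M) :
    ((M.choose J * J.choose e * (M - J).choose f : ℕ) : ℤ) =
      (M.choose (e + f) * (e + f).choose e : ℕ) *
        ibinom ((M : ℤ) - e - f) ((J : ℤ) - e) := by
  unfold ibinom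
  split_ifs with h
  · obtain ⟨i, rfl⟩ : ∃ i, J = i + e := ⟨J - e, by omega⟩
    obtain ⟨l, rfl⟩ : ∃ l, M = i + l + e + f := ⟨M - i - e - f, by omega⟩
    have h₁ : (((i + l + e + f : ℕ) : ℤ) - e - f).toNat = i + l := by omega
    have h₂ : (((i + e : ℕ) : ℤ) - e).toNat = i := by omega
    have h₃ : i + l + e + f - (i + e) = l + f := by omega
    rw [h₁, h₂, h₃]
    exact_mod_cast choose_mul_choose_mul_choose_add i l e f
  · by_cases hJe : J < e
    · simp [Nat.choose_eq_zero_of_lt hJe]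
    · simp [Nat.choose_eq_zero_of_lt (show M - J < f by omega)]

theorem sum_choose_mul_choose_mul_choose_s6 (A e f : ℕ) (g : ℕ → ℝ) :
    ∑ J ∈ Finset.range (A + e + f + 1), ((A + e + f).choose J : ℝ) * J.choose e *
        (A + e + f - J).choose f * g J =
      (A + e + f).choose (e + f) * (e + f).choose e *
        ∑ i ∈ Finset.range (A + 1), (A.choose i : ℝ) * g (i + e) := by
  rw [show A + e + f + 1 = e + (A + 1) + f by ring, Finset.sum_range_add, Finset.sum_range_add,
    Finset.mul_sum]
  rw [Finset.sum_eq_zero (s := Finset.range e), Finset.sum_eq_zero (s := Finset.range f),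
    zero_add, add_zero]
  · refine Finset.sum_congr rfl fun i hi => ?_
    obtain ⟨l, rfl⟩ : ∃ l, A = i + l := ⟨A - i, by rw [Finset.mem_range] at hi; omega⟩
    have h := choose_mul_choose_mul_choose_add i l e f
    rw [show i + l + e + f - (e + i) = l + f by omega, add_comm e i]
    have h' := congrArg (Nat.cast : ℕ → ℝ) h
    push_cast at h'
    linear_combination g (i + e) * h'
  · intro i hi
    rw [Nat.choose_eq_zero_of_lt (show A + e + f - (e + (A + 1) + i) < f by
      rw [Finset.mem_range] at hi; omega)]
    simp
  · intro i hi
    rw [Nat.choose_eq_zero_of_lt (Finset.mem_range.mp hi)]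
    simp

theorem exists_polynomial_choose_mul_choose (M e f : ℕ) :
    ∃ Q : Polynomial ℝ, Q.natDegree ≤ e + f ∧
      ∀ J ≤ M, Q.eval (J : ℝ) = (J.choose e : ℝ) * (M - J).choose f := by
  have key : ∀ s c : ℕ, (descPochhammer ℝ c).eval (s : ℝ) = c.factorial * s.choose c := by
    intro s c
    rw [descPochhammer_eval_eq_descFactorial, Nat.descFactorial_eq_factorial_mul_choose]
    push_cast; ring
  refine ⟨Polynomial.C ((e.factorial : ℝ)⁻¹ * (f.factorial : ℝ)⁻¹) * (descPochhammer ℝ e *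
    (descPochhammer ℝ f).comp (Polynomial.C (M : ℝ) - Polynomial.X)), ?_, fun J hJ => ?_⟩
  · refine (Polynomial.natDegree_C_mul_le _ _).trans (Polynomial.natDegree_mul_le.trans ?_)
    refine add_le_add (descPochhammer_natDegree ..).le (Polynomial.natDegree_comp_le.trans ?_)
    rw [descPochhammer_natDegree]
    refine (Nat.mul_le_mul_left f (Polynomial.natDegree_sub_le _ _)).trans ?_
    simp
  · simp only [Polynomial.eval_mul, Polynomial.eval_C, Polynomial.eval_comp, Polynomial.eval_sub,
      Polynomial.eval_X, ← Nat.cast_sub hJ, key]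
    have := e.factorial_ne_zero
    have := f.factorial_ne_zero
    field_simp

theorem sum_choose_mul_choose_products_eq_zero {N D u v : ℕ} {w : ℕ → ℝ}
    (hw : ∀ e f : ℕ, e + f = D → u ≤ e → v ≤ f →
      ∑ i ∈ Finset.range (N + 1), (N.choose i : ℝ) * w (i + e) = 0)
    {e f e' f' : ℕ} (hD : e + f + (e' + f') ≤ D) (he : u ≤ e) (hf : v ≤ f) :
    ∑ J ∈ Finset.range (N + D + 1), ((N + D).choose J : ℝ) *
      ((J.choose e * (N + D - J).choose f) * (J.choose e' * (N + D - J).choose f')) * w J = 0 := by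
  obtain ⟨Q, hQ, hQe⟩ := exists_polynomial_choose_mul_choose (N + D) e' f'
  obtain ⟨m, rfl⟩ : ∃ m, D = e + f + m := ⟨D - e - f, by omega⟩
  have h := sum_choose_mul_choose_mul_choose_s6 (N + m) e f (fun J => Q.eval (J : ℝ) * w J)
  rw [sum_choose_mul_eval_mul_eq_zero hw (e' + f') hQ (by omega) rfl he hf, mul_zero,
    show N + m + e + f = N + (e + f + m) by ring] at h
  rw [← h]
  refine Finset.sum_congr rfl fun J hJ => ?_
  rw [hQe J (by rw [Finset.mem_range] at hJ; omega)]
  ring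

theorem ibinom_natCast_s6 {M J : ℕ} (h : J ≤ M) : ibinom M J = M.choose J := by
  simp [ibinom, h]

theorem ibinom_nonneg (x k : ℤ) : 0 ≤ ibinom x k := by
  unfold ibinom
  split_ifs <;> positivity

theorem ibinom_ne_zero_imp {x k : ℤ} (h : ibinom x k ≠ 0) : 0 ≤ k ∧ k ≤ x := by
  by_contra hk
  exact h (if_neg hk)

/-- On the shifted support, a Clebsch–Gordan coefficient times `α` is `√C(M,J)` times a combination
of the products `C(J,q-k) * C(M-J,k-(t-r))` times the rescaled `α`, where `M = n - 2t + 2q`. -/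
theorem exists_CG_mul_eq {n t r q a : ℕ} (hn : 2 * t ≤ n) (hr : r ≤ t) (hq : t - r ≤ q)
    {α : ℤ → ℝ} (hα : ∀ j : ℤ, j < 0 ∨ (n : ℤ) < j → α j = 0) :
    ∃ κ : ℕ → ℝ, (∀ k, κ k ≠ 0 → k ≤ a ∧ a + q ≤ k + t + r) ∧
      ∀ J ≤ n - 2 * t + 2 * q, CG n t r q a ((J : ℤ) - q) * α ((J : ℤ) - q + a) =
        √((n - 2 * t + 2 * q).choose J) *
          (∑ k ∈ Finset.Icc (t - r) q,
            κ k * (J.choose (q - k) * (n - 2 * t + 2 * q - J).choose (k - (t - r)))) *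
          (α ((J : ℤ) - q + a) / √(n.choose ((J : ℤ) - q + a).toNat)) := by
  set M := n - 2 * t + 2 * q with hM
  set c := q - (t - r) with hc
  set S : ℝ := √((ibinom (n : ℤ) ((t : ℤ) + r - q) * ibinom (2 * (r : ℤ)) ((r : ℤ) + t - q) : ℤ) /
    (ibinom ((n : ℤ) + q + r - t + 1) ((r : ℤ) + t - q) *
      ibinom (2 * (r : ℤ)) ((a : ℤ) + r - t) : ℤ)) with hS
  refine ⟨fun k => S * ((-1) ^ k * (ibinom ((q : ℤ) - ((t : ℤ) - r)) ((k : ℤ) - ((t : ℤ) - r)) *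
    ibinom ((t : ℤ) + r - q) ((a : ℤ) - k) : ℤ) / (M.choose c * c.choose (q - k) : ℝ)), ?_, ?_⟩
  · intro k hk
    have h : ibinom ((t : ℤ) + r - q) ((a : ℤ) - k) ≠ 0 := by
      rintro h
      simp [h] at hk
    have := ibinom_ne_zero_imp h
    omega
  · intro J hJ
    by_cases hα0 : α ((J : ℤ) - q + a) = 0
    · simp [hα0]
    have hr₀ : ¬ (((J : ℤ) - q + a) < 0 ∨ (n : ℤ) < (J : ℤ) - q + a) := fun h => hα0 (hα _ h)
    obtain ⟨i, hi⟩ : ∃ i : ℕ, (J : ℤ) - q + a = i := ⟨((J : ℤ) - q + a).toNat, by omega⟩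
    have hin : i ≤ n := by omega
    have hMJ : (0 : ℝ) < M.choose J := by exact_mod_cast Nat.choose_pos hJ
    have hni : (0 : ℝ) < n.choose i := by exact_mod_cast Nat.choose_pos hin
    have hsqrt : √(((ibinom (n : ℤ) ((t : ℤ) + r - q) *
          ibinom (2 * (r : ℤ)) ((r : ℤ) + t - q) : ℤ) : ℝ) /
        ((ibinom ((n : ℤ) + q + r - t + 1) ((r : ℤ) + t - q) * ibinom (n : ℤ) i *
            ibinom (2 * (r : ℤ)) ((a : ℤ) + r - t) * ibinom (M : ℤ) J : ℤ) : ℝ)) =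
        S / (√(n.choose i) * √(M.choose J)) := by
      rw [ibinom_natCast_s6 hin, ibinom_natCast_s6 hJ, hS, ← Real.sqrt_mul hni.le,
        ← Real.sqrt_div' _ (by positivity), div_div]
      push_cast
      congr 2
      ring
    have hsum : ∀ k ∈ Finset.Icc (t - r) q,
        (ibinom ((n : ℤ) - 2 * t + q + ((t : ℤ) - r)) ((J : ℤ) - q + k) : ℝ) =
          M.choose J * (J.choose (q - k) * (M - J).choose (k - (t - r))) /
            (M.choose c * c.choose (q - k)) := by
      intro k hk
      rw [Finset.mem_Icc] at hk
      have h := choose_mul_choose_mul_choose_sub (e := q - k) (f := k - (t - r)) hJ (by omega)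
      rw [show q - k + (k - (t - r)) = c by omega,
        show (M : ℤ) - (q - k : ℕ) - (k - (t - r) : ℕ) = (n : ℤ) - 2 * t + q + ((t : ℤ) - r) by omega,
        show (J : ℤ) - (q - k : ℕ) = (J : ℤ) - q + k by omega] at h
      have h₁ : (0 : ℝ) < M.choose c := by exact_mod_cast Nat.choose_pos (by omega)
      have h₂ : (0 : ℝ) < c.choose (q - k) := by exact_mod_cast Nat.choose_pos (by omega)
      rw [eq_div_iff (by positivity)]
      have h' := congrArg (Int.cast : ℤ → ℝ) h
      push_cast at h'
      linear_combination -h'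
    rw [CG, if_pos (by omega), hi, show (J : ℤ) - q + q = J by ring,
      show (n : ℤ) - 2 * t + q + q = M by omega, hsqrt, Int.toNat_natCast]
    have hs : √(M.choose J : ℝ) * √(M.choose J : ℝ) = M.choose J := Real.mul_self_sqrt hMJ.le
    have hs₁ : √(M.choose J : ℝ) ≠ 0 := (Real.sqrt_pos.mpr hMJ).ne'
    have hs₂ : √(n.choose i : ℝ) ≠ 0 := (Real.sqrt_pos.mpr hni).ne'
    rw [Finset.mul_sum, Finset.mul_sum, Finset.sum_mul, Finset.sum_mul]
    refine Finset.sum_congr rfl fun k hk => ?_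
    push_cast
    rw [hsum k hk]
    generalize √(M.choose J : ℝ) = x at hs hs₁
    rw [← hs]
    field_simp

theorem finsum_eq_sum_range_sub {F : ℤ → ℝ} {q M : ℕ}
    (hF : ∀ j : ℤ, F j ≠ 0 → -(q : ℤ) ≤ j ∧ j ≤ (M : ℤ) - q) :
    ∑ᶠ j, F j = ∑ J ∈ Finset.range (M + 1), F ((J : ℤ) - q) := by
  have hinj : Function.Injective (fun J : ℕ => (J : ℤ) - q) := fun x y h => by
    simpa using h
  rw [finsum_eq_sum_of_support_subset (s := (Finset.range (M + 1)).image fun J : ℕ => (J : ℤ) - q),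
    Finset.sum_image hinj.injOn]
  intro j hj
  have := hF j hj
  simp only [Finset.coe_image, Set.mem_image, Finset.mem_coe, Finset.mem_range]
  exact ⟨(j + q).toNat, by omega, by omega⟩

/-- if `α, β` vanish outside `{0,…,n}` and satisfy conditions
(C1)–(C4) with `t′ = 2t`, then for all `r₁, r₂ ≤ t`, all `q` with
`t−r₁ ≤ q ≤ t+r₁` and `t−r₂ ≤ q ≤ t+r₂`, all `a` with `t−r₁ ≤ a ≤ t+r₁` and
all `b` with `t−r₂ ≤ b ≤ t+r₂`:
`Σ_{j∈ℤ} CG(r₁,a,q,j) · CG(r₂,b,q,j) · α_{j+a} · β_{j+b} = 0`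
(the off-diagonal Knill–Laflamme conditions). -/
theorem stmt_6 (n t : ℕ) (hn : 2 * t ≤ n) (α β : ℤ → ℝ)
    (hα : ∀ j : ℤ, j < 0 ∨ (n : ℤ) < j → α j = 0)
    (hβ : ∀ j : ℤ, j < 0 ∨ (n : ℤ) < j → β j = 0)
    (hC1 : ∑ j ∈ Finset.range (n + 1), α j * β j = 0)
    (hC2α : ∑ j ∈ Finset.range (n + 1), (α j) ^ 2 = 1)
    (hC2β : ∑ j ∈ Finset.range (n + 1), (β j) ^ 2 = 1)
    (hC3 : ∀ a b : ℕ, a ≤ 2 * t → b ≤ 2 * t →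
      ∑ j ∈ Finset.range (n - 2 * t + 1),
        ((n - 2 * t).choose j : ℝ) * α ((j : ℤ) + a) * β ((j : ℤ) + b) /
          Real.sqrt ((n.choose (j + a) : ℝ) * (n.choose (j + b) : ℝ)) = 0)
    (hC4 : ∀ a b : ℕ, a ≤ 2 * t → b ≤ 2 * t →
      ∑ j ∈ Finset.range (n - 2 * t + 1),
        ((n - 2 * t).choose j : ℝ) *
          (α ((j : ℤ) + a) * α ((j : ℤ) + b) - β ((j : ℤ) + a) * β ((j : ℤ) + b)) /
          Real.sqrt ((n.choose (j + a) : ℝ) * (n.choose (j + b) : ℝ)) = 0) :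
    ∀ r₁ r₂ q a b : ℕ, r₁ ≤ t → r₂ ≤ t →
      t - r₁ ≤ q → q ≤ t + r₁ → t - r₂ ≤ q → q ≤ t + r₂ →
      t - r₁ ≤ a → a ≤ t + r₁ → t - r₂ ≤ b → b ≤ t + r₂ →
      ∑ᶠ j : ℤ, CG n t r₁ q a j * CG n t r₂ q b j * α (j + a) * β (j + b) = 0 := by
  intro r₁ r₂ q a b hr₁ hr₂ hq₁ hq₁' hq₂ hq₂' ha ha' hb hb'
  set N := n - 2 * t with hN
  set w : ℕ → ℝ := fun J => α ((J : ℤ) - q + a) / √(n.choose ((J : ℤ) - q + a).toNat) *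
    (β ((J : ℤ) - q + b) / √(n.choose ((J : ℤ) - q + b).toNat)) with hw
  have hmom : ∀ e f : ℕ, e + f = 2 * q → q - min a b ≤ e → max a b + q - 2 * t ≤ f →
      ∑ i ∈ Finset.range (N + 1), (N.choose i : ℝ) * w (i + e) = 0 := by
    intro e f hef he hf
    obtain ⟨a', hA⟩ : ∃ a' : ℕ, a' + q = a + e := ⟨a + e - q, by omega⟩
    obtain ⟨b', hB⟩ : ∃ b' : ℕ, b' + q = b + e := ⟨b + e - q, by omega⟩
    rw [← hC3 a' b' (by omega) (by omega)]
    refine Finset.sum_congr rfl fun i _ => ?_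
    simp only [hw]
    rw [show ((i + e : ℕ) : ℤ) - q + a = ((i + a' : ℕ) : ℤ) by omega,
      show ((i + e : ℕ) : ℤ) - q + b = ((i + b' : ℕ) : ℤ) by omega, Int.toNat_natCast,
      Int.toNat_natCast, Real.sqrt_mul (Nat.cast_nonneg _), div_mul_div_comm, ← mul_div_assoc,
      mul_assoc]
    push_cast
    rfl
  obtain ⟨κ, hκ, hCG⟩ := exists_CG_mul_eq (a := a) hn hr₁ hq₁ hα
  obtain ⟨μ, hμ, hCG'⟩ := exists_CG_mul_eq (a := b) hn hr₂ hq₂ hβ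
  rw [finsum_eq_sum_range_sub (q := q) (M := N + 2 * q)]
  swap
  · intro j hj
    have h : CG n t r₁ q a j ≠ 0 := by
      intro h
      simp [h] at hj
    unfold CG at h
    split_ifs at h with hj'
    · omega
    · exact absurd rfl h
  have hexpand : ∀ J ∈ Finset.range (N + 2 * q + 1),
      CG n t r₁ q a ((J : ℤ) - q) * CG n t r₂ q b ((J : ℤ) - q) * α ((J : ℤ) - q + a) *
        β ((J : ℤ) - q + b) =
      ∑ k ∈ Finset.Icc (t - r₁) q, ∑ l ∈ Finset.Icc (t - r₂) q, κ k * μ l *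
        (((N + 2 * q).choose J : ℝ) *
          ((J.choose (q - k) * (N + 2 * q - J).choose (k - (t - r₁))) *
            (J.choose (q - l) * (N + 2 * q - J).choose (l - (t - r₂)))) * w J) := by
    intro J hJ
    have hJ' : J ≤ N + 2 * q := Nat.lt_succ_iff.mp (Finset.mem_range.mp hJ)
    calc _ = (CG n t r₁ q a ((J : ℤ) - q) * α ((J : ℤ) - q + a)) *
          (CG n t r₂ q b ((J : ℤ) - q) * β ((J : ℤ) - q + b)) := by ring
      _ = (√((N + 2 * q).choose J) * √((N + 2 * q).choose J)) *
          ((∑ k ∈ Finset.Icc (t - r₁) q,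
            κ k * (J.choose (q - k) * (N + 2 * q - J).choose (k - (t - r₁)))) *
          ∑ l ∈ Finset.Icc (t - r₂) q,
            μ l * (J.choose (q - l) * (N + 2 * q - J).choose (l - (t - r₂)))) * w J := by
        rw [hCG J hJ', hCG' J hJ']
        ring
      _ = _ := by
        rw [Real.mul_self_sqrt (Nat.cast_nonneg _), Finset.sum_mul_sum, Finset.mul_sum,
          Finset.sum_mul]
        refine Finset.sum_congr rfl fun k _ => ?_
        rw [Finset.mul_sum, Finset.sum_mul]
        refine Finset.sum_congr rfl fun l _ => ?_
        ring
  rw [Finset.sum_congr rfl hexpand, Finset.sum_comm]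
  refine Finset.sum_eq_zero fun k hk => ?_
  rw [Finset.sum_comm]
  refine Finset.sum_eq_zero fun l hl => ?_
  rw [← Finset.mul_sum]
  by_cases hk₀ : κ k = 0
  · simp [hk₀]
  by_cases hl₀ : μ l = 0
  · simp [hl₀]
  have hk' := hκ k hk₀
  have hl' := hμ l hl₀
  rw [Finset.mem_Icc] at hk hl
  refine mul_eq_zero_of_right _ ?_
  rcases le_total a b with hab | hab
  · rw [← sum_choose_mul_choose_products_eq_zero hmom (e := q - k) (f := l - (t - r₂))
      (e' := q - l) (f' := k - (t - r₁)) (by omega) (by omega) (by omega)]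
    exact Finset.sum_congr rfl fun J _ => by ring
  · rw [← sum_choose_mul_choose_products_eq_zero hmom (e := q - l) (f := k - (t - r₁))
      (e' := q - k) (f' := l - (t - r₂)) (by omega) (by omega) (by omega)]
    exact Finset.sum_congr rfl fun J _ => by ring
end

section
/- Let n, t be natural numbers with n ≥ 2t and let γ : {0,…,n} → ℝ. If Σ_{j=0}^{n} γ_j · j^i = 0 for every natural number i ≤ 2t, then Σ_{j=0}^{n} C(j, a) · C(n−j, 2t−a) · γ_j = 0 for every natural number a ≤ 2t. (Applied with γ_j = α_j² − β_j², this shows that the moment conditions Σ_{j=0}^{n}(α_j² − β_j²) j^i = 0, 0 ≤ i ≤ 2t, imply the vanishing of all the weighted binomial sums appearing in the diagonal error-correction conditions.) -/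
open Polynomial in
/-- A weight whose moments up to order `d` vanish annihilates every polynomial of degree at most
`d`. -/
theorem sum_mul_eval_eq_zero_of_moments {R ι : Type*} [CommSemiring R] (s : Finset ι)
    (γ x : ι → R) (d : ℕ) (hmom : ∀ i ≤ d, ∑ j ∈ s, γ j * x j ^ i = 0)
    (p : R[X]) (hp : p.natDegree ≤ d) :
    ∑ j ∈ s, γ j * p.eval (x j) = 0 := by
  simp_rw [eval_eq_sum_range, Finset.mul_sum]
  rw [Finset.sum_comm]
  refine Finset.sum_eq_zero fun i hi => ?_
  have hi' : i ≤ d := by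
    have := Finset.mem_range.mp hi
    omega
  simp_rw [mul_left_comm (γ _), ← Finset.mul_sum, hmom i hi', mul_zero]

open Polynomial in
/-- The product `C(j, a) * C(n - j, b)` is a polynomial in `j` of degree at most `a + b`. -/
theorem exists_polynomial_eval_eq_choose_mul_choose (K : Type*) [Field K] [CharZero K]
    (n a b : ℕ) :
    ∃ p : K[X], p.natDegree ≤ a + b ∧
      ∀ j ≤ n, p.eval (j : K) = (j.choose a : K) * ((n - j).choose b : K) := by
  refine ⟨C ((a.factorial : K)⁻¹ * (b.factorial : K)⁻¹) *
    (descPochhammer K a * (descPochhammer K b).comp (C (n : K) - X)), ?_, fun j hj => ?_⟩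
  · refine (natDegree_C_mul_le _ _).trans (natDegree_mul_le.trans ?_)
    have hX : (C (n : K) - X).natDegree ≤ 1 := by compute_degree
    rw [natDegree_comp, descPochhammer_natDegree, descPochhammer_natDegree]
    exact Nat.add_le_add_left (mul_le_of_le_one_right (Nat.zero_le b) hX) a
  · rw [Nat.cast_choose_eq_descPochhammer_div, Nat.cast_choose_eq_descPochhammer_div,
      Nat.cast_sub hj]
    simp only [eval_mul, eval_C, eval_comp, eval_sub, eval_X]
    ring

/-- let `n ≥ 2t` and `γ : {0,…,n} → ℝ`. If
`Σ_{j=0}^{n} γ_j · j^i = 0` for every natural `i ≤ 2t`, then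
`Σ_{j=0}^{n} C(j,a) · C(n−j, 2t−a) · γ_j = 0` for every natural `a ≤ 2t`. -/
theorem stmt_11 (n t : ℕ) (hn : 2 * t ≤ n) (γ : ℕ → ℝ)
    (hmom : ∀ i : ℕ, i ≤ 2 * t →
      ∑ j ∈ Finset.range (n + 1), γ j * (j : ℝ) ^ i = 0) :
    ∀ a : ℕ, a ≤ 2 * t →
      ∑ j ∈ Finset.range (n + 1),
        (j.choose a : ℝ) * ((n - j).choose (2 * t - a) : ℝ) * γ j = 0 := by
  intro a ha
  obtain ⟨p, hdeg, hp⟩ := exists_polynomial_eval_eq_choose_mul_choose ℝ n a (2 * t - a)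
  rw [← sum_mul_eval_eq_zero_of_moments _ γ (fun j => (j : ℝ)) (2 * t) hmom p (by omega)]
  refine Finset.sum_congr rfl fun j hj => ?_
  rw [hp j (Nat.lt_succ_iff.mp (Finset.mem_range.mp hj)), mul_comm]
end

section
/- Assume the supports of α and β are offset: supp(α) ∩ supp(β) = ∅ and any two distinct elements of supp(α) ∪ supp(β) differ by at least 2t+1, where supp(α) = { j : α_j ≠ 0 } and supp(β) = { j : β_j ≠ 0 }. Then conditions (C3) and (C4) with t′ = 2t hold if and only if Σ_{j=0}^{n} C(j, a) · C(n−j, 2t−a) · ( α_j² − β_j² ) = 0 for every natural number a ≤ 2t. (In particular, under the offset-support assumption condition (C3) holds automatically, since every product α_{j+a}·β_{j+b} with a, b ≤ 2t vanishes, and in (C4) only the diagonal terms a = b can be nonzero.) -/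
theorem choose_mul_choose_mul_choose_eq (a b p q : ℕ) :
    (p + q).choose p * (a + b + (p + q)).choose (a + b) * (a + b).choose a =
      (a + b + (p + q)).choose (p + a) * (p + a).choose a * (q + b).choose b := by
  have hfac (i j : ℕ) : (i + j).choose i * i.factorial * j.factorial = (i + j).factorial := by
    rw [Nat.choose_symm_add, Nat.add_choose_mul_factorial_mul_factorial]
  have h₁ := hfac p q
  have h₂ := hfac (a + b) (p + q)
  have h₃ := hfac a b
  have h₄ := hfac (p + a) (q + b)
  have h₅ := Nat.add_choose_mul_factorial_mul_factorial p a
  have h₆ := Nat.add_choose_mul_factorial_mul_factorial q b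
  rw [show p + a + (q + b) = a + b + (p + q) by ring] at h₄
  have hpos : 0 < a.factorial * b.factorial * p.factorial * q.factorial := by positivity
  refine Nat.eq_of_mul_eq_mul_right hpos ?_
  calc
    _ = (a + b + (p + q)).choose (a + b) * ((a + b).choose a * a.factorial * b.factorial) *
        ((p + q).choose p * p.factorial * q.factorial) := by ring
    _ = (a + b + (p + q)).choose (p + a) * ((p + a).choose a * p.factorial * a.factorial) *
        ((q + b).choose b * q.factorial * b.factorial) := by rw [h₁, h₃, h₂, h₅, h₆, h₄]
    _ = _ := by ring

/-- Reindexing a sum weighted by `C(k, a) * C(n - k, m - a)` by `k = j + a`. -/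
theorem sum_choose_mul_choose_eq (n m a : ℕ) (hm : m ≤ n) (ha : a ≤ m) (g : ℕ → ℝ) :
    ∑ k ∈ Finset.range (n + 1), (k.choose a : ℝ) * ((n - k).choose (m - a) : ℝ) * g k =
      (n.choose m * m.choose a : ℝ) *
        ∑ j ∈ Finset.range (n - m + 1),
          ((n - m).choose j : ℝ) * g (j + a) / (n.choose (j + a) : ℝ) := by
  have hsub : Finset.Ico (0 + a) (n - m + 1 + a) ⊆ Finset.range (n + 1) := by
    intro k hk
    simp only [Finset.mem_Ico, Finset.mem_range] at *
    omega
  rw [← Finset.sum_subset hsub, ← Finset.sum_Ico_add', Finset.mul_sum, Finset.range_eq_Ico]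
  · refine Finset.sum_congr rfl fun j hj => ?_
    simp only [Finset.mem_Ico] at hj
    obtain ⟨b, rfl⟩ := Nat.exists_eq_add_of_le ha
    obtain ⟨q, rfl⟩ : ∃ q, n = a + b + (j + q) := ⟨n - (a + b) - j, by omega⟩
    have h : ((j + q).choose j * (a + b + (j + q)).choose (a + b) * (a + b).choose a : ℝ) =
        (a + b + (j + q)).choose (j + a) * (j + a).choose a * (q + b).choose b :=
      mod_cast choose_mul_choose_mul_choose_eq a b j q
    have hne : ((a + b + (j + q)).choose (j + a) : ℝ) ≠ 0 := by
      exact_mod_cast (Nat.choose_pos (by omega)).ne'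
    rw [show a + b + (j + q) - (j + a) = q + b by omega, Nat.add_sub_cancel_left,
      Nat.add_sub_cancel_left]
    field_simp
    linear_combination -g (j + a) * h
  · intro k hk hk'
    simp only [Finset.mem_Ico, Finset.mem_range] at hk hk'
    rcases lt_or_ge k a with h | h
    · simp [Nat.choose_eq_zero_of_lt h]
    · simp [Nat.choose_eq_zero_of_lt (show n - k < m - a by omega)]

/-- let `n ≥ 2t` and let `α, β : ℤ → ℝ` vanish outside `{0,…,n}`,
with offset supports: `supp(α) ∩ supp(β) = ∅` and any two distinct elements of
`supp(α) ∪ supp(β)` differ by at least `2t+1`. Then conditions (C3) and (C4)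
with `t′ = 2t` hold if and only if
`Σ_{j=0}^{n} C(j,a) · C(n−j, 2t−a) · (α_j² − β_j²) = 0` for every natural `a ≤ 2t`. -/
theorem stmt_12 (n t : ℕ) (hn : 2 * t ≤ n) (α β : ℤ → ℝ)
    (hα : ∀ j : ℤ, j < 0 ∨ (n : ℤ) < j → α j = 0)
    (hβ : ∀ j : ℤ, j < 0 ∨ (n : ℤ) < j → β j = 0)
    (hdisj : ∀ j : ℤ, α j = 0 ∨ β j = 0)
    (hsep : ∀ j j' : ℤ, (α j ≠ 0 ∨ β j ≠ 0) → (α j' ≠ 0 ∨ β j' ≠ 0) → j ≠ j' →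
      (2 * (t : ℤ) + 1) ≤ |j - j'|) :
    ((∀ a b : ℕ, a ≤ 2 * t → b ≤ 2 * t →
        ∑ j ∈ Finset.range (n - 2 * t + 1),
          ((n - 2 * t).choose j : ℝ) * α ((j : ℤ) + a) * β ((j : ℤ) + b) /
            Real.sqrt ((n.choose (j + a) : ℝ) * (n.choose (j + b) : ℝ)) = 0) ∧
      (∀ a b : ℕ, a ≤ 2 * t → b ≤ 2 * t →
        ∑ j ∈ Finset.range (n - 2 * t + 1),
          ((n - 2 * t).choose j : ℝ) *
            (α ((j : ℤ) + a) * α ((j : ℤ) + b) - β ((j : ℤ) + a) * β ((j : ℤ) + b)) /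
            Real.sqrt ((n.choose (j + a) : ℝ) * (n.choose (j + b) : ℝ)) = 0)) ↔
      (∀ a : ℕ, a ≤ 2 * t →
        ∑ j ∈ Finset.range (n + 1),
          (j.choose a : ℝ) * ((n - j).choose (2 * t - a) : ℝ) *
            ((α (j : ℤ)) ^ 2 - (β (j : ℤ)) ^ 2) = 0) := by
  have hdiag (a : ℕ) (ha : a ≤ 2 * t) :
      ∑ j ∈ Finset.range (n + 1),
        (j.choose a : ℝ) * ((n - j).choose (2 * t - a) : ℝ) *
          ((α (j : ℤ)) ^ 2 - (β (j : ℤ)) ^ 2) = 0 ↔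
      ∑ j ∈ Finset.range (n - 2 * t + 1),
        ((n - 2 * t).choose j : ℝ) *
          (α ((j : ℤ) + a) * α ((j : ℤ) + a) - β ((j : ℤ) + a) * β ((j : ℤ) + a)) /
          Real.sqrt ((n.choose (j + a) : ℝ) * (n.choose (j + a) : ℝ)) = 0 := by
    have hc : (n.choose (2 * t) * (2 * t).choose a : ℝ) ≠ 0 := by
      exact_mod_cast (Nat.mul_pos (Nat.choose_pos hn) (Nat.choose_pos ha)).ne'
    rw [sum_choose_mul_choose_eq n (2 * t) a hn ha
      (fun k => (α (k : ℤ)) ^ 2 - (β (k : ℤ)) ^ 2), mul_eq_zero, or_iff_right hc]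
    simp only [Real.sqrt_mul_self (Nat.cast_nonneg _), Nat.cast_add, pow_two]
  have hoff {a b : ℕ} (ha : a ≤ 2 * t) (hb : b ≤ 2 * t) (hab : a ≠ b) (j : ℕ) :
      (α ((j : ℤ) + a) = 0 ∧ β ((j : ℤ) + a) = 0) ∨
        (α ((j : ℤ) + b) = 0 ∧ β ((j : ℤ) + b) = 0) := by
    by_contra! h
    have key := hsep ((j : ℤ) + a) ((j : ℤ) + b) (or_iff_not_imp_left.2 fun h' => h.1 (not_not.1 h'))
      (or_iff_not_imp_left.2 fun h' => h.2 (not_not.1 h')) (by omega)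
    rcases abs_cases ((j : ℤ) + a - ((j : ℤ) + b)) with h' | h' <;> omega
  constructor
  · rintro ⟨-, h⟩ a ha
    exact (hdiag a ha).2 (h a a ha ha)
  · refine fun h => ⟨fun a b ha hb => Finset.sum_eq_zero fun j _ => ?_, fun a b ha hb => ?_⟩
    · rcases eq_or_ne a b with rfl | hab
      · rcases hdisj ((j : ℤ) + a) with h' | h' <;> simp [h']
      · rcases hoff ha hb hab j with h' | h' <;> simp [h']
    · rcases eq_or_ne a b with rfl | hab
      · exact (hdiag a ha).1 (h a ha)
      · refine Finset.sum_eq_zero fun j _ => ?_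
        rcases hoff ha hb hab j with h' | h' <;> simp [h']
end
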